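/- arXiv:math/0103156 — 6 statements merged into one kernel-verified Lean document; each statement's English description precedes it below -/
import Mathlib

section
/- For every v ∈ V with ‖v‖ < r, the map B_v sends {x ∈ V' : ‖x‖ ≤ r} into itself; more precisely ‖B_v(x)‖ ≤ (1/3)(‖v‖ + ‖x‖) for every x ∈ V' with ‖x‖ ≤ r. Moreover ‖B_v(x₁) − B_v(x₂)‖ ≤ (1/3)‖x₁ − x₂‖ for all x₁, x₂ ∈ V' with ‖x₁‖, ‖x₂‖ ≤ r, and ‖B_{v₁}(x) − B_{v₂}(x)‖ ≤ (1/3)‖v₁ − v₂‖ for all v₁, v₂ ∈ V with ‖v₁‖, ‖v₂‖ < r and all x ∈ V' with ‖x‖ ≤ r. -/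
/-- A selection of `E'`-components in a decomposition with ratio `c` is `c`-Lipschitz. -/
theorem norm_component_sub_le {Y : Type*} [NormedAddCommGroup Y] [NormedSpace ℝ Y] {c : ℝ}
    {E' E : Submodule ℝ Y} (hratio : ∀ e' ∈ E', ∀ e ∈ E, ‖e'‖ ≤ c * ‖e' + e‖)
    {P : Y → Y} (hP : ∀ y : Y, P y ∈ E' ∧ y - P y ∈ E) (a b : Y) :
    ‖P a - P b‖ ≤ c * ‖a - b‖ := by
  have h := hratio _ (E'.sub_mem (hP a).1 (hP b).1) _ (E.sub_mem (hP a).2 (hP b).2)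
  rwa [show P a - P b + (a - P a - (b - P b)) = a - b by abel] at h

/-- Mean value inequality on a convex set, with a weight on the derivative bound. -/
theorem Convex.mul_norm_image_sub_le_of_mul_norm_hasFDerivAt_le {X Y : Type*}
    [NormedAddCommGroup X] [NormedSpace ℝ X] [NormedAddCommGroup Y] [NormedSpace ℝ Y]
    {G : X → Y} {G' : X → X →L[ℝ] Y} {s : Set X} {k C : ℝ} (hk : 0 ≤ k) (hs : Convex ℝ s)
    (hG : ∀ x ∈ s, HasFDerivAt G (G' x) x) (hbound : ∀ x ∈ s, k * ‖G' x‖ ≤ C)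
    {a b : X} (ha : a ∈ s) (hb : b ∈ s) : k * ‖G a - G b‖ ≤ C * ‖a - b‖ := by
  have h := hs.norm_image_sub_le_of_norm_hasFDerivWithin_le (f := fun x => k • G x)
    (f' := fun x => k • G' x) (C := C)
    (fun x hx => ((hG x hx).const_smul k).hasFDerivWithinAt)
    (fun x hx => by
      rw [norm_smul, Real.norm_of_nonneg hk]
      exact hbound x hx) hb ha
  rwa [← smul_sub, norm_smul, Real.norm_of_nonneg hk] at h

/-- **Properties of the maps `B_v` in the Kuranishi model construction.**
`X, Y` are real Banach spaces, `r, c > 0`.  `F : X → Y`, `F 0 = 0`, Fréchet differentiable on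
`B(0, 2r)` with derivative `DF x`; `L : X →L Y`; `E ⊆ Y` a finite-dimensional subspace,
`V = L⁻¹(E)`, `V' ⊆ X`, `E' ⊆ Y` closed with `X = V ⊕ V'`, `Y = E' ⊕ E`, `L : V' → E'`
invertible with continuous inverse `Linv`; the decompositions have ratio `c`; `P : Y → E'`
is the projection with kernel `E`; `c‖L⁻¹‖‖DG(x)‖ ≤ 1/3` on `B(0,2r)` where `G = F - L`;
`B v x = -L⁻¹(P(G(v+x)))`.  Then for `v ∈ V`, `‖v‖ < r`: `B_v` sends the closed `r`-ball of
`V'` into itself with `‖B v x‖ ≤ (1/3)(‖v‖+‖x‖)`; `B_v` is `1/3`-Lipschitz in `x`; and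
`‖B v₁ x - B v₂ x‖ ≤ (1/3)‖v₁ - v₂‖`. -/
theorem stmt_2 {X Y : Type*}
    [NormedAddCommGroup X] [NormedSpace ℝ X] [CompleteSpace X]
    [NormedAddCommGroup Y] [NormedSpace ℝ Y] [CompleteSpace Y]
    (r c : ℝ) (hr : 0 < r) (hc : 0 < c)
    (F : X → Y) (hF0 : F 0 = 0)
    (DF : X → X →L[ℝ] Y)
    (hDF : ∀ x ∈ Metric.ball (0 : X) (2 * r), HasFDerivAt F (DF x) x)
    (L : X →L[ℝ] Y)
    (E : Submodule ℝ Y) (hEfin : FiniteDimensional ℝ E)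
    (V' : Submodule ℝ X) (E' : Submodule ℝ Y)
    (hV'closed : IsClosed (V' : Set X)) (hE'closed : IsClosed (E' : Set Y))
    (hVcompl : IsCompl (Submodule.comap (L : X →ₗ[ℝ] Y) E) V')
    (hEcompl : IsCompl E' E)
    (hratioX : ∀ v ∈ Submodule.comap (L : X →ₗ[ℝ] Y) E, ∀ v' ∈ V',
      ‖v‖ ≤ c * ‖v + v'‖ ∧ ‖v'‖ ≤ c * ‖v + v'‖)
    (hratioY : ∀ e' ∈ E', ∀ e ∈ E, ‖e'‖ ≤ c * ‖e' + e‖ ∧ ‖e‖ ≤ c * ‖e' + e‖)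
    (Linv : Y →L[ℝ] X)
    (hLinvV' : ∀ y ∈ E', Linv y ∈ V')
    (hLinvL : ∀ x ∈ V', Linv (L x) = x)
    (hLLinv : ∀ y ∈ E', L (Linv y) = y)
    (P : Y → Y) (hP : ∀ y : Y, P y ∈ E' ∧ y - P y ∈ E)
    (hsmall : ∀ x ∈ Metric.ball (0 : X) (2 * r), c * ‖Linv‖ * ‖DF x - L‖ ≤ 1 / 3)
    (B : X → X → X)
    (hB : ∀ v x : X, B v x = -(Linv (P (F (v + x) - L (v + x))))) :
    (∀ v ∈ Submodule.comap (L : X →ₗ[ℝ] Y) E, ‖v‖ < r → ∀ x ∈ V', ‖x‖ ≤ r →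
      B v x ∈ V' ∧ ‖B v x‖ ≤ (1 / 3) * (‖v‖ + ‖x‖) ∧ ‖B v x‖ ≤ r) ∧
    (∀ v ∈ Submodule.comap (L : X →ₗ[ℝ] Y) E, ‖v‖ < r →
      ∀ x₁ ∈ V', ∀ x₂ ∈ V', ‖x₁‖ ≤ r → ‖x₂‖ ≤ r →
        ‖B v x₁ - B v x₂‖ ≤ (1 / 3) * ‖x₁ - x₂‖) ∧
    (∀ v₁ ∈ Submodule.comap (L : X →ₗ[ℝ] Y) E, ∀ v₂ ∈ Submodule.comap (L : X →ₗ[ℝ] Y) E,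
      ‖v₁‖ < r → ‖v₂‖ < r → ∀ x ∈ V', ‖x‖ ≤ r →
        ‖B v₁ x - B v₂ x‖ ≤ (1 / 3) * ‖v₁ - v₂‖) := by
  have hPlip := norm_component_sub_le (fun e' he' e he => (hratioY e' he' e he).1) hP
  have hball : ∀ v x : X, ‖v‖ < r → ‖x‖ ≤ r → v + x ∈ Metric.ball (0 : X) (2 * r) := by
    intro v x hv hx
    rw [mem_ball_zero_iff]
    linarith [norm_add_le v x]
  have hlip : ∀ a ∈ Metric.ball (0 : X) (2 * r), ∀ b ∈ Metric.ball (0 : X) (2 * r),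
      ‖Linv (P (F a - L a)) - Linv (P (F b - L b))‖ ≤ 1 / 3 * ‖a - b‖ := by
    intro a ha b hb
    calc ‖Linv (P (F a - L a)) - Linv (P (F b - L b))‖
        ≤ ‖Linv‖ * ‖P (F a - L a) - P (F b - L b)‖ := by
          rw [← map_sub]
          exact Linv.le_opNorm _
      _ ≤ ‖Linv‖ * (c * ‖(F a - L a) - (F b - L b)‖) := by
          gcongr
          exact hPlip _ _
      _ = c * ‖Linv‖ * ‖(F a - L a) - (F b - L b)‖ := by ring
      _ ≤ 1 / 3 * ‖a - b‖ :=
          (convex_ball (0 : X) (2 * r)).mul_norm_image_sub_le_of_mul_norm_hasFDerivAt_le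
            (G := fun x => F x - L x) (by positivity)
            (fun x hx => (hDF x hx).sub L.hasFDerivAt) hsmall ha hb
  have hP0 : P 0 = 0 := by
    have h := (hratioY _ (hP 0).1 _ (hP 0).2).1
    simpa using h
  refine ⟨fun v _ hv x _ hx => ?_, fun v _ hv x₁ _ x₂ _ hx₁ hx₂ => ?_,
    fun v₁ _ v₂ _ hv₁ hv₂ x _ hx => ?_⟩
  · have h : ‖B v x‖ ≤ 1 / 3 * (‖v‖ + ‖x‖) := by
      have h0 := hlip _ (hball v x hv hx) 0 (Metric.mem_ball_self (by positivity))
      simp only [hF0, map_zero, sub_zero, hP0] at h0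
      rw [hB, norm_neg]
      linarith [norm_add_le v x]
    refine ⟨?_, h, by linarith⟩
    rw [hB]
    exact V'.neg_mem (hLinvV' _ (hP _).1)
  · have h := hlip _ (hball v x₁ hv hx₁) _ (hball v x₂ hv hx₂)
    rwa [add_sub_add_left_eq_sub, ← norm_neg, neg_sub', ← hB, ← hB] at h
  · have h := hlip _ (hball v₁ x hv₁ hx) _ (hball v₂ x hv₂ hx)
    rwa [add_sub_add_right_eq_sub, ← norm_neg, neg_sub', ← hB, ← hB] at h
end

section
/- For every v ∈ V with ‖v‖ < r there exists a unique element v'(v) ∈ V' with ‖v'(v)‖ ≤ r such that F(v + v'(v)) ∈ E; moreover this element satisfies ‖v'(v)‖ ≤ ‖v‖/2. -/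
/-- **Existence and uniqueness of `v'(v)` in the Kuranishi model construction.**
Under the hypotheses of the Kuranishi model setup (see the paper's Lemma 3.2.1):
for every `v ∈ V` with `‖v‖ < r` there is a unique `w ∈ V'` with `‖w‖ ≤ r` such that
`F(v + w) ∈ E`; moreover this element satisfies `‖w‖ ≤ ‖v‖ / 2`. -/
theorem stmt_3 {X Y : Type*}
    [NormedAddCommGroup X] [NormedSpace ℝ X] [CompleteSpace X]
    [NormedAddCommGroup Y] [NormedSpace ℝ Y] [CompleteSpace Y]
    (r c : ℝ) (hr : 0 < r) (hc : 0 < c)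
    (F : X → Y) (hF0 : F 0 = 0)
    (DF : X → X →L[ℝ] Y)
    (hDF : ∀ x ∈ Metric.ball (0 : X) (2 * r), HasFDerivAt F (DF x) x)
    (L : X →L[ℝ] Y)
    (E : Submodule ℝ Y) (hEfin : FiniteDimensional ℝ E)
    (V' : Submodule ℝ X) (E' : Submodule ℝ Y)
    (hV'closed : IsClosed (V' : Set X)) (hE'closed : IsClosed (E' : Set Y))
    (hVcompl : IsCompl (Submodule.comap (L : X →ₗ[ℝ] Y) E) V')
    (hEcompl : IsCompl E' E)
    (hratioX : ∀ v ∈ Submodule.comap (L : X →ₗ[ℝ] Y) E, ∀ v' ∈ V',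
      ‖v‖ ≤ c * ‖v + v'‖ ∧ ‖v'‖ ≤ c * ‖v + v'‖)
    (hratioY : ∀ e' ∈ E', ∀ e ∈ E, ‖e'‖ ≤ c * ‖e' + e‖ ∧ ‖e‖ ≤ c * ‖e' + e‖)
    (Linv : Y →L[ℝ] X)
    (hLinvV' : ∀ y ∈ E', Linv y ∈ V')
    (hLinvL : ∀ x ∈ V', Linv (L x) = x)
    (hLLinv : ∀ y ∈ E', L (Linv y) = y)
    (P : Y → Y) (hP : ∀ y : Y, P y ∈ E' ∧ y - P y ∈ E)
    (hsmall : ∀ x ∈ Metric.ball (0 : X) (2 * r), c * ‖Linv‖ * ‖DF x - L‖ ≤ 1 / 3) :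
    ∀ v ∈ Submodule.comap (L : X →ₗ[ℝ] Y) E, ‖v‖ < r →
      (∃! w : X, w ∈ V' ∧ ‖w‖ ≤ r ∧ F (v + w) ∈ E) ∧
      (∀ w : X, w ∈ V' → ‖w‖ ≤ r → F (v + w) ∈ E → ‖w‖ ≤ ‖v‖ / 2) := by
  intro v hv hvr
  have hLv : L v ∈ E := hv
  have mem_zero : ∀ y ∈ E', y ∈ E → y = 0 := fun y h₁ h₂ =>
    (Submodule.disjoint_def.1 hEcompl.disjoint) y h₁ h₂
  have hLV' : ∀ x ∈ V', L x ∈ E' := by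
    intro x hx
    have hx' : x - Linv (P (L x)) = 0 := by
      refine (Submodule.disjoint_def.1 hVcompl.disjoint) _ ?_
        (V'.sub_mem hx (hLinvV' _ (hP _).1))
      change L (x - Linv (P (L x))) ∈ E
      rw [map_sub, hLLinv _ (hP _).1]
      exact (hP _).2
    rw [sub_eq_zero.1 hx', hLLinv _ (hP _).1]
    exact (hP _).1
  have hPlip : ∀ y z : Y, ‖P y - P z‖ ≤ c * ‖y - z‖ := by
    intro y z
    have h := (hratioY _ (E'.sub_mem (hP y).1 (hP z).1) _ (E.sub_mem (hP y).2 (hP z).2)).1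
    rwa [show P y - P z + (y - P y - (z - P z)) = y - z by abel] at h
  have hP0 : P 0 = 0 := by
    refine mem_zero _ (hP 0).1 ?_
    simpa using (hP 0).2
  have hGlip : ∀ x ∈ Metric.ball (0 : X) (2 * r), ∀ y ∈ Metric.ball (0 : X) (2 * r),
      ‖Linv (P (F x - L x)) - Linv (P (F y - L y))‖ ≤ 1 / 3 * ‖x - y‖ := by
    intro x hx y hy
    have hk : 0 ≤ c * ‖Linv‖ := by positivity
    have hmean := (convex_ball (0 : X) (2 * r)).norm_image_sub_le_of_norm_hasFDerivWithin_le
      (f := fun z => (c * ‖Linv‖) • (F z - L z)) (f' := fun z => (c * ‖Linv‖) • (DF z - L))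
      (C := 1 / 3)
      (fun z hz => (((hDF z hz).sub L.hasFDerivAt).const_smul (c * ‖Linv‖)).hasFDerivWithinAt)
      (fun z hz => by
        rw [norm_smul, Real.norm_of_nonneg hk]
        exact hsmall z hz) hy hx
    rw [← smul_sub, norm_smul, Real.norm_of_nonneg hk] at hmean
    calc ‖Linv (P (F x - L x)) - Linv (P (F y - L y))‖
        ≤ ‖Linv‖ * ‖P (F x - L x) - P (F y - L y)‖ := by
          rw [← map_sub]
          exact Linv.le_opNorm _
      _ ≤ ‖Linv‖ * (c * ‖F x - L x - (F y - L y)‖) := by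
          gcongr
          exact hPlip _ _
      _ = c * ‖Linv‖ * ‖F x - L x - (F y - L y)‖ := by ring
      _ ≤ 1 / 3 * ‖x - y‖ := hmean
  have hball : ∀ w : X, ‖w‖ ≤ r → v + w ∈ Metric.ball (0 : X) (2 * r) := by
    intro w hw
    rw [mem_ball_zero_iff]
    linarith [norm_add_le v w]
  set B : X → X := fun w => -Linv (P (F (v + w) - L (v + w))) with hB
  have hBlip : ∀ w₁ w₂ : X, ‖w₁‖ ≤ r → ‖w₂‖ ≤ r → ‖B w₁ - B w₂‖ ≤ 1 / 3 * ‖w₁ - w₂‖ := by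
    intro w₁ w₂ h₁ h₂
    have h := hGlip _ (hball w₁ h₁) _ (hball w₂ h₂)
    rw [add_sub_add_left_eq_sub] at h
    rwa [hB, neg_sub_neg, norm_sub_rev]
  have hBnorm : ∀ w : X, ‖w‖ ≤ r → ‖B w‖ ≤ 1 / 3 * (‖v‖ + ‖w‖) := by
    intro w hw
    have h := hGlip _ (hball w hw) 0 (Metric.mem_ball_self (by linarith))
    simp only [hF0, map_zero, sub_zero, hP0] at h
    rw [hB, norm_neg]
    linarith [norm_add_le v w]
  have hBV' : ∀ w : X, B w ∈ V' := fun w => V'.neg_mem (hLinvV' _ (hP _).1)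
  have hfix : ∀ w ∈ V', F (v + w) ∈ E → B w = w := by
    intro w hw hF
    have hsum : P (F (v + w) - L (v + w)) + L w = 0 := by
      refine mem_zero _ (E'.add_mem (hP _).1 (hLV' w hw)) ?_
      have h := E.sub_mem (E.sub_mem hF hLv) (hP (F (v + w) - L (v + w))).2
      convert h using 1
      rw [map_add]
      abel
    rw [hB]
    dsimp only
    rw [eq_neg_of_add_eq_zero_left hsum, map_neg, neg_neg, hLinvL w hw]
  have hfix' : ∀ w : X, B w = w → F (v + w) ∈ E := by
    intro w hw
    have hLw : L w = -P (F (v + w) - L (v + w)) := by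
      conv_lhs => rw [← hw]
      rw [hB, map_neg, hLLinv _ (hP _).1]
    have h := E.add_mem (hP (F (v + w) - L (v + w))).2 hLv
    convert h using 1
    rw [sub_eq_add_neg _ (P _), ← hLw, map_add]
    abel
  have hmaps : Set.MapsTo B (Metric.closedBall 0 r) (Metric.closedBall 0 r) := by
    intro w hw
    rw [mem_closedBall_zero_iff] at hw ⊢
    linarith [hBnorm w hw]
  have hcontr : ContractingWith (1 / 3) (hmaps.restrict B _ _) := by
    refine ⟨by rw [← NNReal.coe_lt_coe]; norm_num, LipschitzWith.of_dist_le_mul ?_⟩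
    rintro ⟨x, hx⟩ ⟨y, hy⟩
    rw [mem_closedBall_zero_iff] at hx hy
    simpa [Subtype.dist_eq, dist_eq_norm] using hBlip x y hx hy
  obtain ⟨w, hw, hwB, -⟩ := hcontr.exists_fixedPoint' Metric.isClosed_closedBall.isComplete hmaps
    (Metric.mem_closedBall_self hr.le) (edist_ne_top _ _)
  rw [mem_closedBall_zero_iff] at hw
  have hwB : B w = w := hwB
  refine ⟨⟨w, ⟨hwB ▸ hBV' w, hw, hfix' w hwB⟩, ?_⟩, ?_⟩
  · rintro u ⟨huV, hu, huE⟩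
    have h := hBlip u w hu hw
    rw [hfix u huV huE, hwB] at h
    exact sub_eq_zero.1 (norm_le_zero_iff.1 (by linarith))
  · intro u huV hu huE
    have h := hBnorm u hu
    rw [hfix u huV huE] at h
    linarith
end

section
/- The map v ↦ v'(v) satisfies ‖v'(v₁) − v'(v₂)‖ ≤ (2/3)·‖v₁ − v₂‖ for all v₁, v₂ ∈ V with ‖v₁‖ < r and ‖v₂‖ < r; consequently the map ψ : v ↦ v + v'(v) is injective on {v ∈ V : ‖v‖ < r} and is Lipschitz continuous there. -/
/-- If `w ∈ V'` satisfies `L w + d ∈ E`, then `w` is controlled by `d` through the right inverse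
`Linv` of `L` and the ratio `c` of the decomposition `Y = E' ⊕ E`. -/
theorem norm_le_of_map_add_mem {X Y : Type*}
    [NormedAddCommGroup X] [NormedSpace ℝ X] [NormedAddCommGroup Y] [NormedSpace ℝ Y]
    {c : ℝ} {L : X →L[ℝ] Y} {E : Submodule ℝ Y} {V' : Submodule ℝ X} {E' : Submodule ℝ Y}
    (hVcompl : IsCompl (Submodule.comap (L : X →ₗ[ℝ] Y) E) V')
    (hEcompl : IsCompl E' E)
    (hratioY : ∀ e' ∈ E', ∀ e ∈ E, ‖e'‖ ≤ c * ‖e' + e‖ ∧ ‖e‖ ≤ c * ‖e' + e‖)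
    {Linv : Y →L[ℝ] X}
    (hLinvV' : ∀ y ∈ E', Linv y ∈ V')
    (hLLinv : ∀ y ∈ E', L (Linv y) = y)
    {w : X} (hw : w ∈ V') {d : Y} (hd : L w + d ∈ E) :
    ‖w‖ ≤ c * ‖Linv‖ * ‖d‖ := by
  obtain ⟨p, hp, q, hq, rfl⟩ : ∃ p ∈ E', ∃ q ∈ E, p + q = d :=
    Submodule.mem_sup.mp (hEcompl.sup_eq_top ▸ Submodule.mem_top)
  have hV : w + Linv p ∈ Submodule.comap (L : X →ₗ[ℝ] Y) E := by
    have h := E.sub_mem hd hq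
    simpa [hLLinv p hp, ← add_assoc] using h
  have hzero : w + Linv p = 0 :=
    Submodule.disjoint_def.mp hVcompl.disjoint _ hV (V'.add_mem hw (hLinvV' p hp))
  calc ‖w‖ = ‖Linv p‖ := by rw [eq_neg_of_add_eq_zero_left hzero, norm_neg]
    _ ≤ ‖Linv‖ * ‖p‖ := Linv.le_opNorm p
    _ ≤ ‖Linv‖ * (c * ‖p + q‖) := by gcongr; exact (hratioY p hp q hq).1
    _ = c * ‖Linv‖ * ‖p + q‖ := by ring

/-- Mean value inequality for `F - L` on a ball, with the derivative bound scaled by `k ≥ 0`. -/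
theorem mul_norm_sub_sub_map_le {X Y : Type*}
    [NormedAddCommGroup X] [NormedSpace ℝ X] [NormedAddCommGroup Y] [NormedSpace ℝ Y]
    {R k C : ℝ} (hk : 0 ≤ k) {F : X → Y} {DF : X → X →L[ℝ] Y} {L : X →L[ℝ] Y}
    (hDF : ∀ x ∈ Metric.ball (0 : X) R, HasFDerivAt F (DF x) x)
    (hsmall : ∀ x ∈ Metric.ball (0 : X) R, k * ‖DF x - L‖ ≤ C)
    {x y : X} (hx : x ∈ Metric.ball (0 : X) R) (hy : y ∈ Metric.ball (0 : X) R) :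
    k * ‖(F y - L y) - (F x - L x)‖ ≤ C * ‖y - x‖ := by
  have h := (convex_ball (0 : X) R).norm_image_sub_le_of_norm_hasFDerivWithin_le
    (f := fun x => k • (F x - L x)) (f' := fun x => k • (DF x - L)) (C := C)
    (fun z hz => (((hDF z hz).sub L.hasFDerivAt).const_smul k).hasFDerivWithinAt)
    (fun z hz => by
      rw [norm_smul, Real.norm_of_nonneg hk]
      exact hsmall z hz) hx hy
  rwa [← smul_sub, norm_smul, Real.norm_of_nonneg hk] at h

/-- **Lipschitz property of `v ↦ v'(v)` and injectivity of `ψ : v ↦ v + v'(v)`.**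
Under the hypotheses of the Kuranishi model setup, with `vfix v` the unique element of `V'`
of norm `≤ r` with `F(v + vfix v) ∈ E` (for `v ∈ V`, `‖v‖ < r`):
`‖vfix v₁ - vfix v₂‖ ≤ (2/3)‖v₁ - v₂‖`; consequently `ψ : v ↦ v + vfix v` is injective
on `{v ∈ V : ‖v‖ < r}` and Lipschitz continuous there. -/
theorem stmt_4 {X Y : Type*}
    [NormedAddCommGroup X] [NormedSpace ℝ X] [CompleteSpace X]
    [NormedAddCommGroup Y] [NormedSpace ℝ Y] [CompleteSpace Y]
    (r c : ℝ) (hr : 0 < r) (hc : 0 < c)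
    (F : X → Y) (hF0 : F 0 = 0)
    (DF : X → X →L[ℝ] Y)
    (hDF : ∀ x ∈ Metric.ball (0 : X) (2 * r), HasFDerivAt F (DF x) x)
    (L : X →L[ℝ] Y)
    (E : Submodule ℝ Y) (hEfin : FiniteDimensional ℝ E)
    (V' : Submodule ℝ X) (E' : Submodule ℝ Y)
    (hV'closed : IsClosed (V' : Set X)) (hE'closed : IsClosed (E' : Set Y))
    (hVcompl : IsCompl (Submodule.comap (L : X →ₗ[ℝ] Y) E) V')
    (hEcompl : IsCompl E' E)
    (hratioX : ∀ v ∈ Submodule.comap (L : X →ₗ[ℝ] Y) E, ∀ v' ∈ V',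
      ‖v‖ ≤ c * ‖v + v'‖ ∧ ‖v'‖ ≤ c * ‖v + v'‖)
    (hratioY : ∀ e' ∈ E', ∀ e ∈ E, ‖e'‖ ≤ c * ‖e' + e‖ ∧ ‖e‖ ≤ c * ‖e' + e‖)
    (Linv : Y →L[ℝ] X)
    (hLinvV' : ∀ y ∈ E', Linv y ∈ V')
    (hLinvL : ∀ x ∈ V', Linv (L x) = x)
    (hLLinv : ∀ y ∈ E', L (Linv y) = y)
    (P : Y → Y) (hP : ∀ y : Y, P y ∈ E' ∧ y - P y ∈ E)
    (hsmall : ∀ x ∈ Metric.ball (0 : X) (2 * r), c * ‖Linv‖ * ‖DF x - L‖ ≤ 1 / 3)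
    (vfix : X → X)
    (hvfix : ∀ v ∈ Submodule.comap (L : X →ₗ[ℝ] Y) E, ‖v‖ < r →
      vfix v ∈ V' ∧ ‖vfix v‖ ≤ r ∧ F (v + vfix v) ∈ E)
    (hvfixU : ∀ v ∈ Submodule.comap (L : X →ₗ[ℝ] Y) E, ‖v‖ < r →
      ∀ w ∈ V', ‖w‖ ≤ r → F (v + w) ∈ E → w = vfix v) :
    (∀ v₁ ∈ Submodule.comap (L : X →ₗ[ℝ] Y) E, ∀ v₂ ∈ Submodule.comap (L : X →ₗ[ℝ] Y) E,
      ‖v₁‖ < r → ‖v₂‖ < r → ‖vfix v₁ - vfix v₂‖ ≤ (2 / 3) * ‖v₁ - v₂‖) ∧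
    Set.InjOn (fun v => v + vfix v)
      {v : X | v ∈ Submodule.comap (L : X →ₗ[ℝ] Y) E ∧ ‖v‖ < r} ∧
    ∃ K : NNReal, LipschitzOnWith K (fun v => v + vfix v)
      {v : X | v ∈ Submodule.comap (L : X →ₗ[ℝ] Y) E ∧ ‖v‖ < r} := by
  have key : ∀ v₁ ∈ Submodule.comap (L : X →ₗ[ℝ] Y) E,
      ∀ v₂ ∈ Submodule.comap (L : X →ₗ[ℝ] Y) E, ‖v₁‖ < r → ‖v₂‖ < r →
      ‖vfix v₁ - vfix v₂‖ ≤ (2 / 3) * ‖v₁ - v₂‖ := by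
    intro v₁ hv₁ v₂ hv₂ hr₁ hr₂
    obtain ⟨hw₁, hn₁, hF₁⟩ := hvfix v₁ hv₁ hr₁
    obtain ⟨hw₂, hn₂, hF₂⟩ := hvfix v₂ hv₂ hr₂
    have hx₁ : v₁ + vfix v₁ ∈ Metric.ball (0 : X) (2 * r) := by
      rw [mem_ball_zero_iff]
      linarith [norm_add_le v₁ (vfix v₁)]
    have hx₂ : v₂ + vfix v₂ ∈ Metric.ball (0 : X) (2 * r) := by
      rw [mem_ball_zero_iff]
      linarith [norm_add_le v₂ (vfix v₂)]
    have hw : vfix v₁ - vfix v₂ ∈ V' := V'.sub_mem hw₁ hw₂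
    have hLv : L (v₁ - v₂) ∈ E := Submodule.sub_mem _ hv₁ hv₂
    have hd := norm_le_of_map_add_mem hVcompl hEcompl hratioY hLinvV' hLLinv hw
      (d := (F (v₁ + vfix v₁) - L (v₁ + vfix v₁)) - (F (v₂ + vfix v₂) - L (v₂ + vfix v₂)))
      (by
        have h := E.sub_mem (E.sub_mem hF₁ hF₂) hLv
        convert h using 1
        simp only [map_add, map_sub]
        abel)
    have hmv := mul_norm_sub_sub_map_le (by positivity) hDF hsmall hx₂ hx₁
    have htri : ‖v₁ + vfix v₁ - (v₂ + vfix v₂)‖ ≤ ‖v₁ - v₂‖ + ‖vfix v₁ - vfix v₂‖ := by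
      rw [add_sub_add_comm]
      exact norm_add_le _ _
    linarith [norm_nonneg (v₁ - v₂)]
  refine ⟨key, ?_, 5 / 3, ?_⟩
  · rintro v₁ ⟨hv₁, hr₁⟩ v₂ ⟨hv₂, hr₂⟩ h
    have hk := key v₁ hv₁ v₂ hv₂ hr₁ hr₂
    have h' : v₁ - v₂ = -(vfix v₁ - vfix v₂) := by
      refine eq_neg_of_add_eq_zero_left ?_
      rw [← add_sub_add_comm]
      exact sub_eq_zero.mpr h
    rw [← norm_neg, ← h'] at hk
    have h0 : ‖v₁ - v₂‖ = 0 := by linarith [norm_nonneg (v₁ - v₂)]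
    exact sub_eq_zero.mp (norm_eq_zero.mp h0)
  · refine LipschitzOnWith.of_dist_le_mul ?_
    rintro v₁ ⟨hv₁, hr₁⟩ v₂ ⟨hv₂, hr₂⟩
    have hk := key v₁ hv₁ v₂ hv₂ hr₁ hr₂
    simp only [dist_eq_norm, add_sub_add_comm]
    push_cast
    linarith [norm_add_le (v₁ - v₂) (vfix v₁ - vfix v₂)]
end

section
/- Let W := {v ∈ V : ‖v‖ < r and ‖ψ(v)‖ < r/c} and define f : W → E by f(v) := F(ψ(v)) (this lies in E). Then f is continuous, and ψ restricts to a homeomorphism from the zero set f⁻¹(0) = {v ∈ W : F(ψ(v)) = 0} onto the set {x ∈ X : ‖x‖ < r/c and F(x) = 0}. -/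
/-- If `b * ‖DF x - L‖ ≤ k` on a convex set, then `b • (F - L)` is Lipschitz there with constant
`k`. -/
theorem mul_norm_sub_sub_le_of_hasFDerivAt {X Y : Type*}
    [NormedAddCommGroup X] [NormedSpace ℝ X] [NormedAddCommGroup Y] [NormedSpace ℝ Y]
    {F : X → Y} {DF : X → X →L[ℝ] Y} {L : X →L[ℝ] Y} {s : Set X} (hs : Convex ℝ s)
    (hDF : ∀ x ∈ s, HasFDerivAt F (DF x) x) {b k : ℝ} (hb : 0 ≤ b)
    (hsmall : ∀ x ∈ s, b * ‖DF x - L‖ ≤ k) {x y : X} (hx : x ∈ s) (hy : y ∈ s) :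
    b * ‖(F x - L x) - (F y - L y)‖ ≤ k * ‖x - y‖ := by
  have h := hs.norm_image_sub_le_of_norm_hasFDerivWithin_le
    (f := fun z => b • (F z - L z)) (f' := fun z => b • (DF z - L)) (C := k)
    (fun z hz => (((hDF z hz).sub L.hasFDerivAt).const_smul b).hasFDerivWithinAt)
    (fun z hz => by
      rw [norm_smul, Real.norm_of_nonneg hb]
      exact hsmall z hz) hy hx
  rwa [← smul_sub, norm_smul, Real.norm_of_nonneg hb] at h

/-- A linear map with a right inverse `E' → V'` maps `V'` into `E'`,
when `V'` meets the preimage of a complement `E` of `E'` trivially. -/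
theorem map_mem_of_rightInverse_of_disjoint_comap {X Y : Type*}
    [AddCommGroup X] [Module ℝ X] [AddCommGroup Y] [Module ℝ Y]
    {L : X →ₗ[ℝ] Y} {A : Y →ₗ[ℝ] X} {E E' : Submodule ℝ Y} {V' : Submodule ℝ X}
    (hV : Disjoint (E.comap L) V') (hE : Codisjoint E' E)
    (hAV' : ∀ y ∈ E', A y ∈ V') (hLA : ∀ y ∈ E', L (A y) = y)
    {x : X} (hx : x ∈ V') : L x ∈ E' := by
  obtain ⟨e', e, he', he, hsum⟩ := Submodule.codisjoint_iff_exists_add_eq.mp hE (L x)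
  have hmem : x - A e' ∈ V' := V'.sub_mem hx (hAV' e' he')
  have hL : L (x - A e') = e := by rw [map_sub, hLA e' he', ← hsum, add_sub_cancel_left]
  have hzero : x - A e' = 0 :=
    Submodule.disjoint_def.mp hV _ (by rw [Submodule.mem_comap, hL]; exact he) hmem
  rw [sub_eq_zero.mp hzero, hLA e' he']
  exact he'


/-- **The Kuranishi model: continuity of `f` and the homeomorphism onto the zero set.**
Under the hypotheses of the Kuranishi model setup, with `vfix v` the unique element of `V'`
of norm `≤ r` such that `F(v + vfix v) ∈ E` (for `v ∈ V`, `‖v‖ < r`), let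
`W = {v ∈ V : ‖v‖ < r, ‖ψ v‖ < r/c}` where `ψ v = v + vfix v`, and `f v = F (ψ v)`.
Then `f` takes values in `E` on `W`, `f` is continuous on `W`, and `ψ` restricts to a
homeomorphism from `{v ∈ W : F (ψ v) = 0}` onto `{x : ‖x‖ < r/c, F x = 0}`. -/
theorem stmt_6 {X Y : Type*}
    [NormedAddCommGroup X] [NormedSpace ℝ X] [CompleteSpace X]
    [NormedAddCommGroup Y] [NormedSpace ℝ Y] [CompleteSpace Y]
    (r c : ℝ) (hr : 0 < r) (hc : 0 < c)
    (F : X → Y) (hF0 : F 0 = 0)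
    (DF : X → X →L[ℝ] Y)
    (hDF : ∀ x ∈ Metric.ball (0 : X) (2 * r), HasFDerivAt F (DF x) x)
    (L : X →L[ℝ] Y)
    (E : Submodule ℝ Y) (hEfin : FiniteDimensional ℝ E)
    (V' : Submodule ℝ X) (E' : Submodule ℝ Y)
    (hV'closed : IsClosed (V' : Set X)) (hE'closed : IsClosed (E' : Set Y))
    (hVcompl : IsCompl (Submodule.comap (L : X →ₗ[ℝ] Y) E) V')
    (hEcompl : IsCompl E' E)
    (hratioX : ∀ v ∈ Submodule.comap (L : X →ₗ[ℝ] Y) E, ∀ v' ∈ V',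
      ‖v‖ ≤ c * ‖v + v'‖ ∧ ‖v'‖ ≤ c * ‖v + v'‖)
    (hratioY : ∀ e' ∈ E', ∀ e ∈ E, ‖e'‖ ≤ c * ‖e' + e‖ ∧ ‖e‖ ≤ c * ‖e' + e‖)
    (Linv : Y →L[ℝ] X)
    (hLinvV' : ∀ y ∈ E', Linv y ∈ V')
    (hLinvL : ∀ x ∈ V', Linv (L x) = x)
    (hLLinv : ∀ y ∈ E', L (Linv y) = y)
    (P : Y → Y) (hP : ∀ y : Y, P y ∈ E' ∧ y - P y ∈ E)
    (hsmall : ∀ x ∈ Metric.ball (0 : X) (2 * r), c * ‖Linv‖ * ‖DF x - L‖ ≤ 1 / 3)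
    (vfix : X → X)
    (hvfix : ∀ v ∈ Submodule.comap (L : X →ₗ[ℝ] Y) E, ‖v‖ < r →
      vfix v ∈ V' ∧ ‖vfix v‖ ≤ r ∧ F (v + vfix v) ∈ E)
    (hvfixU : ∀ v ∈ Submodule.comap (L : X →ₗ[ℝ] Y) E, ‖v‖ < r →
      ∀ w ∈ V', ‖w‖ ≤ r → F (v + w) ∈ E → w = vfix v) :
    (∀ v : X, v ∈ Submodule.comap (L : X →ₗ[ℝ] Y) E → ‖v‖ < r → ‖v + vfix v‖ < r / c →
      F (v + vfix v) ∈ E) ∧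
    ContinuousOn (fun v => F (v + vfix v))
      {v : X | v ∈ Submodule.comap (L : X →ₗ[ℝ] Y) E ∧ ‖v‖ < r ∧ ‖v + vfix v‖ < r / c} ∧
    ∃ e : {v : X // v ∈ Submodule.comap (L : X →ₗ[ℝ] Y) E ∧ ‖v‖ < r ∧
            ‖v + vfix v‖ < r / c ∧ F (v + vfix v) = 0} ≃ₜ
          {x : X // ‖x‖ < r / c ∧ F x = 0},
      ∀ a, (e a : X) = (a : X) + vfix (a : X) := by
  have hF : ∀ v w : X, ‖v‖ < r → ‖w‖ ≤ r → v + w ∈ Metric.ball (0 : X) (2 * r) := by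
    intro v w hv hw
    rw [mem_ball_zero_iff]
    linarith [norm_add_le v w]
  have hLV' : ∀ x ∈ V', L x ∈ E' := fun x hx =>
    map_mem_of_rightInverse_of_disjoint_comap (L := (L : X →ₗ[ℝ] Y)) (A := (Linv : Y →ₗ[ℝ] X))
      hVcompl.disjoint hEcompl.codisjoint hLinvV' hLLinv hx
  have hlip : ∀ v ∈ Submodule.comap (L : X →ₗ[ℝ] Y) E, ‖v‖ < r →
      ∀ u ∈ Submodule.comap (L : X →ₗ[ℝ] Y) E, ‖u‖ < r →
      ‖(v + vfix v) - (u + vfix u)‖ ≤ 3 / 2 * ‖v - u‖ := by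
    intro v hv hvr u hu hur
    obtain ⟨hv1, hv2, hv3⟩ := hvfix v hv hvr
    obtain ⟨hu1, hu2, hu3⟩ := hvfix u hu hur
    have hG := mul_norm_sub_sub_le_of_hasFDerivAt (convex_ball (0 : X) (2 * r)) hDF
      (by positivity : 0 ≤ c * ‖Linv‖) hsmall (hF v _ hvr hv2) (hF u _ hur hu2)
    have hw : vfix v - vfix u ∈ V' := V'.sub_mem hv1 hu1
    have hE : F (v + vfix v) - F (u + vfix u) - L (v - u) ∈ E :=
      E.sub_mem (E.sub_mem hv3 hu3) ((Submodule.comap (L : X →ₗ[ℝ] Y) E).sub_mem hv hu)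
    have hsplit : -L (vfix v - vfix u) + (F (v + vfix v) - F (u + vfix u) - L (v - u)) =
        (F (v + vfix v) - L (v + vfix v)) - (F (u + vfix u) - L (u + vfix u)) := by
      simp only [map_sub, map_add]
      abel
    have hcomp := (hratioY _ (E'.neg_mem (hLV' _ hw)) _ hE).1
    rw [hsplit, norm_neg] at hcomp
    have hinv : ‖vfix v - vfix u‖ ≤ ‖Linv‖ * ‖L (vfix v - vfix u)‖ := by
      simpa only [hLinvL _ hw] using Linv.le_opNorm (L (vfix v - vfix u))
    have hmul := mul_le_mul_of_nonneg_left hcomp (norm_nonneg Linv)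
    have htri : ‖(v + vfix v) - (u + vfix u)‖ ≤ ‖v - u‖ + ‖vfix v - vfix u‖ := by
      rw [add_sub_add_comm]
      exact norm_add_le _ _
    linarith
  have hanti : ∀ v ∈ Submodule.comap (L : X →ₗ[ℝ] Y) E, ‖v‖ < r →
      ∀ u ∈ Submodule.comap (L : X →ₗ[ℝ] Y) E, ‖u‖ < r →
      ‖v - u‖ ≤ c * ‖(v + vfix v) - (u + vfix u)‖ := by
    intro v hv hvr u hu hur
    rw [add_sub_add_comm]
    exact (hratioX _ (Submodule.sub_mem _ hv hu) _
      (V'.sub_mem (hvfix v hv hvr).1 (hvfix u hu hur).1)).1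
  refine ⟨fun v hv hvr _ => (hvfix v hv hvr).2.2, ?_, ?_⟩
  · have hψ : ContinuousOn (fun v => v + vfix v)
        {v : X | v ∈ Submodule.comap (L : X →ₗ[ℝ] Y) E ∧ ‖v‖ < r ∧ ‖v + vfix v‖ < r / c} :=
      (LipschitzOnWith.of_dist_le_mul (K := 3 / 2) fun v hv u hu => by
        simpa [dist_eq_norm] using hlip v hv.1 hv.2.1 u hu.1 hu.2.1).continuousOn
    have hFc : ContinuousOn F (Metric.ball (0 : X) (2 * r)) := fun x hx =>
      (hDF x hx).continuousAt.continuousWithinAt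
    exact hFc.comp hψ fun v hv => hF v _ hv.2.1 (hvfix v hv.1 hv.2.1).2.1
  · let g : {v : X // v ∈ Submodule.comap (L : X →ₗ[ℝ] Y) E ∧ ‖v‖ < r ∧
        ‖v + vfix v‖ < r / c ∧ F (v + vfix v) = 0} → {x : X // ‖x‖ < r / c ∧ F x = 0} :=
      fun a => ⟨(a : X) + vfix (a : X), a.2.2.2⟩
    have hgl : LipschitzWith (3 / 2) g := LipschitzWith.of_dist_le_mul fun v u => by
      simpa [g, Subtype.dist_eq, dist_eq_norm] using
        hlip v v.2.1 v.2.2.1 u u.2.1 u.2.2.1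
    have hga : AntilipschitzWith c.toNNReal g := AntilipschitzWith.of_le_mul_dist fun v u => by
      simpa only [g, Subtype.dist_eq, dist_eq_norm, Real.coe_toNNReal c hc.le] using
        hanti v v.2.1 v.2.2.1 u u.2.1 u.2.2.1
    have hgs : Function.Surjective g := by
      rintro ⟨x, hxr, hx0⟩
      obtain ⟨v, w, hv, hw, rfl⟩ :=
        Submodule.codisjoint_iff_exists_add_eq.mp hVcompl.codisjoint x
      have hcx : c * ‖v + w‖ < r := by
        rw [mul_comm]
        exact (lt_div_iff₀ hc).mp hxr
      obtain ⟨hv', hw'⟩ := hratioX v hv w hw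
      have hvr : ‖v‖ < r := hv'.trans_lt hcx
      obtain rfl : w = vfix v :=
        hvfixU v hv hvr w hw (hw'.trans hcx.le) (by rw [hx0]; exact E.zero_mem)
      exact ⟨⟨v, hv, hvr, hxr, hx0⟩, rfl⟩
    exact ⟨(Equiv.ofBijective g ⟨hga.injective, hgs⟩).toHomeomorphOfIsInducing
      (hga.isUniformInducing hgl.uniformContinuous).isInducing, fun _ => rfl⟩
end

section
/- Let (V, G, π) be a uniformizing system of a connected topological space U, with V locally connected, and let U' ⊆ U be a nonempty connected open subset. Let V' be a connected component of π⁻¹(U'), let G' := {g ∈ G : g·V' = V'} (the subgroup of G fixing V' setwise), and let π' be the restriction of π to V'. Then V' is open in V, π'(V') = U', π' is G'-invariant, and the induced map V'/G' → U' is a homeomorphism; that is, (V', G', π') is a uniformizing system of U'. -/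
open Pointwise

/-- A uniformizing system of a connected topological space `U` consists of a connected
topological space `V`, a finite group `G` acting on `V` by homeomorphisms, and a continuous
`G`-invariant surjection `π : V → U` inducing a homeomorphism `V/G ≃ U`.  The last condition
is encoded as: `π` is a quotient map whose fibers are exactly the `G`-orbits. -/
structure IsUniformizingSystem (G : Type*) {V U : Type*} [TopologicalSpace V]
    [TopologicalSpace U] [Group G] [MulAction G V] (π : V → U) : Prop where
  connectedSpace : ConnectedSpace V
  continuous_smul : ∀ g : G, Continuous fun x : V => g • x
  isQuotientMap : Topology.IsQuotientMap π
  orbit_eq : ∀ x y : V, π x = π y ↔ ∃ g : G, g • x = y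

namespace IsUniformizingSystem

variable {G V U : Type*} [TopologicalSpace V] [TopologicalSpace U] [Group G] [MulAction G V]
  {π : V → U}

theorem map_smul (hπ : IsUniformizingSystem G π) (g : G) (x : V) : π (g • x) = π x :=
  ((hπ.orbit_eq x (g • x)).2 ⟨g, rfl⟩).symm

theorem isOpenMap (hπ : IsUniformizingSystem G π) : IsOpenMap π := by
  intro W hW
  have h : π ⁻¹' (π '' W) = ⋃ g : G, (fun x : V => g • x) ⁻¹' W := by
    ext y
    simp only [Set.mem_preimage, Set.mem_image, Set.mem_iUnion]
    constructor
    · rintro ⟨x, hx, hxy⟩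
      obtain ⟨g, rfl⟩ := (hπ.orbit_eq y x).1 hxy.symm
      exact ⟨g, hx⟩
    · rintro ⟨g, hg⟩
      exact ⟨g • y, hg, hπ.map_smul g y⟩
  rw [← hπ.isQuotientMap.isOpen_preimage, h]
  exact isOpen_iUnion fun g => hW.preimage (hπ.continuous_smul g)

theorem smul_preimage (hπ : IsUniformizingSystem G π) (g : G) (S : Set U) :
    g • (π ⁻¹' S) = π ⁻¹' S := by
  ext x
  simp [Set.mem_smul_set_iff_inv_smul_mem, hπ.map_smul]

theorem smul_connectedComponentIn_preimage (hπ : IsUniformizingSystem G π) (g : G) {S : Set U}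
    {x : V} (hx : π x ∈ S) :
    g • connectedComponentIn (π ⁻¹' S) x = connectedComponentIn (π ⁻¹' S) (g • x) := by
  have : ContinuousConstSMul G V := ⟨hπ.continuous_smul⟩
  have h := (Homeomorph.smul g : V ≃ₜ V).image_connectedComponentIn (s := π ⁻¹' S) hx
  change g • connectedComponentIn (π ⁻¹' S) x =
    connectedComponentIn (g • (π ⁻¹' S)) (g • x) at h
  rwa [hπ.smul_preimage] at h

theorem image_connectedComponentIn_preimage [LocallyConnectedSpace V]
    (hπ : IsUniformizingSystem G π) {S : Set U} (hS : IsOpen S) (hSc : IsPreconnected S)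
    {x : V} (hx : π x ∈ S) : π '' connectedComponentIn (π ⁻¹' S) x = S := by
  have hP : IsOpen (π ⁻¹' S) := hS.preimage hπ.isQuotientMap.continuous
  have hopen (y : V) : IsOpen (π '' connectedComponentIn (π ⁻¹' S) y) :=
    hπ.isOpenMap _ hP.connectedComponentIn
  refine (Set.image_subset_iff.2 (connectedComponentIn_subset _ _)).antisymm ?_
  set C := connectedComponentIn (π ⁻¹' S) x with hC
  let I := {y : V | π y ∈ S ∧ π y ∉ π '' C}
  refine hSc.subset_left_of_subset_union (hopen x)
    (isOpen_biUnion fun y (_ : y ∈ I) => hopen y) ?_ ?_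
    ⟨π x, hx, Set.mem_image_of_mem π (mem_connectedComponentIn hx)⟩
  · refine Set.disjoint_iUnion₂_right.2 fun y hy => Set.disjoint_left.2 ?_
    rintro _ ⟨a, ha, rfl⟩ ⟨b, hb, hab⟩
    obtain ⟨g, rfl⟩ := (hπ.orbit_eq b a).1 hab
    have hgC : g • connectedComponentIn (π ⁻¹' S) y = C := by
      rw [connectedComponentIn_eq hb, hC, connectedComponentIn_eq ha]
      exact hπ.smul_connectedComponentIn_preimage g (connectedComponentIn_subset (π ⁻¹' S) y hb)
    exact hy.2 ⟨g • y, hgC ▸ Set.smul_mem_smul_set (mem_connectedComponentIn hy.1),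
      hπ.map_smul g y⟩
  · intro u hu
    by_cases huC : u ∈ π '' C
    · exact Or.inl huC
    · obtain ⟨y, rfl⟩ := hπ.isQuotientMap.surjective u
      exact Or.inr (Set.mem_biUnion (show y ∈ I from ⟨hu, huC⟩)
        (Set.mem_image_of_mem π (mem_connectedComponentIn hu)))

end IsUniformizingSystem

/-- **Induced uniformizing system on a connected open subset (existence part of Lemma 4.1.1).**
Let `(V, G, π)` uniformize the connected space `U`, with `V` locally connected, and let
`U' ⊆ U` be a nonempty connected open subset.  Let `V's` be a connected component of
`π⁻¹(U')`, `G' = {g : G | g • V's = V's}`, and `π'` the restriction of `π`.  Then `V's` is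
open, `π` maps `V's` onto `U'`, `π'` is `G'`-invariant, and the induced map `V's/G' → U'`
is a homeomorphism, i.e. `(V's, G', π')` is a uniformizing system of `U'` (encoded as: the
restriction `V's → U'` is a quotient map whose fibers are exactly the `G'`-orbits). -/
theorem stmt_10 {V U G : Type*} [TopologicalSpace V] [TopologicalSpace U]
    [Group G] [Finite G] [MulAction G V]
    [ConnectedSpace U] [LocallyConnectedSpace V]
    (π : V → U) (hπ : IsUniformizingSystem G π)
    (U' : Set U) (hU'ne : U'.Nonempty) (hU'conn : IsConnected U') (hU'open : IsOpen U')
    (V's : Set V) (hV's : ∃ x ∈ π ⁻¹' U', V's = connectedComponentIn (π ⁻¹' U') x) :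
    IsOpen V's ∧
    IsConnected V's ∧
    π '' V's = U' ∧
    (∀ g : G, g • V's = V's → ∀ x ∈ V's, π (g • x) = π x) ∧
    ∃ hmaps : Set.MapsTo π V's U',
      Topology.IsQuotientMap (Set.MapsTo.restrict π V's U' hmaps) ∧
      ∀ x y : V's, π (x : V) = π (y : V) ↔
        ∃ g : G, g • V's = V's ∧ g • (x : V) = (y : V) := by
  obtain ⟨x, hx, rfl⟩ := hV's
  have hCopen : IsOpen (connectedComponentIn (π ⁻¹' U') x) :=
    (hU'open.preimage hπ.isQuotientMap.continuous).connectedComponentIn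
  have himage := hπ.image_connectedComponentIn_preimage hU'open hU'conn.isPreconnected hx
  have hmaps : Set.MapsTo π (connectedComponentIn (π ⁻¹' U') x) U' :=
    connectedComponentIn_subset _ _
  refine ⟨hCopen, isConnected_connectedComponentIn_iff.2 hx, himage,
    fun g _ y _ => hπ.map_smul g y, hmaps, ?_, fun a b => ⟨fun hab => ?_, ?_⟩⟩
  · refine IsOpenMap.isQuotientMap ?_ (hπ.isQuotientMap.continuous.restrict hmaps) ?_
    · exact (hπ.isOpenMap.comp hCopen.isOpenMap_subtype_val).subtype_mk fun a => hmaps a.2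
    · exact (Set.MapsTo.restrict_surjective_iff hmaps).2 himage.ge
  · obtain ⟨g, hg⟩ := (hπ.orbit_eq a b).1 hab
    refine ⟨g, ?_, hg⟩
    calc g • connectedComponentIn (π ⁻¹' U') x
        = g • connectedComponentIn (π ⁻¹' U') (a : V) :=
          congrArg (g • ·) (connectedComponentIn_eq a.2)
      _ = connectedComponentIn (π ⁻¹' U') (b : V) := by
        rw [hπ.smul_connectedComponentIn_preimage g (hmaps a.2), hg]
      _ = connectedComponentIn (π ⁻¹' U') x := (connectedComponentIn_eq b.2).symm
  · rintro ⟨g, -, hg⟩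
    exact (hπ.orbit_eq a b).2 ⟨g, hg⟩
end

section
/- Let (V, G, π) be a uniformizing system of a connected topological space U, with V Hausdorff and first-countable, and let U' ⊆ U be a nonempty connected open subset. Let (V₁, G₁, π₁) be a uniformizing system of U' with V₁ first-countable, and let ψ : V₁ → V be a continuous map which is a homeomorphism onto an open subset of V and satisfies π ∘ ψ = π₁. Then ψ(V₁) is a connected component of π⁻¹(U'). -/
/-- The projection of a uniformizing system is an open map. -/
theorem IsUniformizingSystem.isOpenMap_s11 {G V U : Type*} [TopologicalSpace V] [TopologicalSpace U]
    [Group G] [MulAction G V] {π : V → U} (hπ : IsUniformizingSystem G π) : IsOpenMap π := by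
  intro O hO
  rw [← hπ.isQuotientMap.isOpen_preimage]
  have h : π ⁻¹' (π '' O) = ⋃ g : G, (fun x : V => g • x) ⁻¹' O := by
    ext x
    simp only [Set.mem_preimage, Set.mem_image, Set.mem_iUnion]
    constructor
    · rintro ⟨y, hy, hyx⟩
      obtain ⟨g, rfl⟩ := (hπ.orbit_eq x y).1 hyx.symm
      exact ⟨g, hy⟩
    · rintro ⟨g, hg⟩
      exact ⟨g • x, hg, ((hπ.orbit_eq x _).2 ⟨g, rfl⟩).symm⟩
  rw [h]
  exact isOpen_iUnion fun g => hO.preimage (hπ.continuous_smul g)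

/-- A continuous lift to a Hausdorff space of the projection of a uniformizing system of an open
set `U'` has relatively closed range in the part lying over `U'`. -/
theorem IsUniformizingSystem.closure_range_inter_subset {V U G₁ V₁ : Type*} [TopologicalSpace V]
    [TopologicalSpace U] [T2Space V] [TopologicalSpace V₁] [Group G₁] [Finite G₁] [MulAction G₁ V₁]
    {π : V → U} (hπ : Continuous π) {U' : Set U} (hU' : IsOpen U')
    {π₁ : V₁ → U'} (hπ₁ : IsUniformizingSystem G₁ π₁) {ψ : V₁ → V} (hψ : Continuous ψ)
    (hcomm : ∀ x : V₁, π (ψ x) = (π₁ x : U)) :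
    closure (Set.range ψ) ∩ π ⁻¹' U' ⊆ Set.range ψ := by
  rintro y ⟨hy, hyU⟩
  by_contra hne
  obtain ⟨v, hv⟩ := hπ₁.isQuotientMap.surjective ⟨π y, hyU⟩
  have hsep (g : G₁) : ∃ M N : Set V, IsOpen M ∧ IsOpen N ∧ ψ (g • v) ∈ M ∧ y ∈ N ∧
      Disjoint M N := t2_separation fun h => hne ⟨_, h⟩
  choose M N hM hN hvM hyN hMN using hsep
  let O : Set V₁ := ⋂ g : G₁, (fun x => ψ (g • x)) ⁻¹' M g
  have hO : IsOpen O :=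
    isOpen_iInter_of_finite fun g => (hM g).preimage (hψ.comp (hπ₁.continuous_smul g))
  have hvO : v ∈ O := Set.mem_iInter.2 hvM
  have hW : IsOpen ((↑) '' (π₁ '' O) : Set U) :=
    hU'.isOpenMap_subtype_val _ (hπ₁.isOpenMap_s11 O hO)
  obtain ⟨_, ⟨hzN, _, ⟨o, ho, rfl⟩, hoz⟩, u, rfl⟩ := mem_closure_iff.1 hy
    ((⋂ g, N g) ∩ π ⁻¹' ((↑) '' (π₁ '' O)))
    ((isOpen_iInter_of_finite hN).inter (hW.preimage hπ))
    ⟨Set.mem_iInter.2 hyN, π₁ v, ⟨v, hvO, rfl⟩, by rw [hv]⟩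
  rw [hcomm u] at hoz
  obtain ⟨g, rfl⟩ := (hπ₁.orbit_eq o u).1 (Subtype.ext hoz)
  exact Set.disjoint_left.1 (hMN g) (Set.mem_iInter.1 ho g) (Set.mem_iInter.1 hzN g)

/-- **Uniqueness part of Lemma 4.1.1.**
Let `(V, G, π)` uniformize the connected space `U`, with `V` Hausdorff and first-countable,
and let `U' ⊆ U` be a nonempty connected open subset.  Let `(V₁, G₁, π₁)` be a uniformizing
system of `U'` with `V₁` first-countable, and let `ψ : V₁ → V` be a continuous map which is
a homeomorphism onto an open subset of `V` (an open embedding) with `π ∘ ψ = π₁`.  Then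
`ψ(V₁)` is a connected component of `π⁻¹(U')`. -/
theorem stmt_11 {V U G : Type*} [TopologicalSpace V] [TopologicalSpace U]
    [Group G] [Finite G] [MulAction G V]
    [ConnectedSpace U] [T2Space V] [FirstCountableTopology V]
    (π : V → U) (hπ : IsUniformizingSystem G π)
    (U' : Set U) (hU'ne : U'.Nonempty) (hU'conn : IsConnected U') (hU'open : IsOpen U')
    {V₁ G₁ : Type*} [TopologicalSpace V₁] [FirstCountableTopology V₁]
    [Group G₁] [Finite G₁] [MulAction G₁ V₁]
    (π₁ : V₁ → U') (hπ₁ : IsUniformizingSystem G₁ π₁)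
    (ψ : V₁ → V) (hψ : Topology.IsOpenEmbedding ψ)
    (hcomm : ∀ x : V₁, π (ψ x) = (π₁ x : U)) :
    ∃ x ∈ π ⁻¹' U', Set.range ψ = connectedComponentIn (π ⁻¹' U') x := by
  have := hπ₁.connectedSpace
  obtain ⟨v⟩ : Nonempty V₁ := inferInstance
  have hsub : Set.range ψ ⊆ π ⁻¹' U' := by
    rintro _ ⟨x, rfl⟩
    rw [Set.mem_preimage, hcomm]
    exact (π₁ x).2
  have hv : ψ v ∈ Set.range ψ := ⟨v, rfl⟩
  refine ⟨ψ v, hsub hv, Set.Subset.antisymm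
    ((isPreconnected_range hψ.continuous).subset_connectedComponentIn hv hsub) ?_⟩
  refine isPreconnected_connectedComponentIn.subset_of_closure_inter_subset hψ.isOpen_range
    ⟨ψ v, mem_connectedComponentIn (hsub hv), hv⟩ ?_
  exact (Set.inter_subset_inter_right _ (connectedComponentIn_subset _ _)).trans
    (hπ₁.closure_range_inter_subset hπ.isQuotientMap.continuous hU'open hψ.continuous hcomm)
end
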